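/- arXiv:0911.1815 — 2 statements merged into one kernel-verified Lean document; each statement's English description precedes it below -/
import Mathlib

section
/- (Zeros Lemma) Let x ∈ ℝ^d, m > d/2, r > 0. Suppose Υ ⊂ B(x, 3r) is a norming set for polynomials of degree ≤ m−1 on B(x, 3r) with norming constant κ. Then there is a constant C depending only on m, κ, d such that for every f ∈ W_2^m(B(x,3r)) vanishing on Υ, Σ_{k ≤ m} r^{2(k−m)} |f|²_{W_2^k(B(x,r))} ≤ C |f|²_{W_2^m(B(x,3r))}. -/
/-- Evaluation of a multivariate polynomial at a point of ℝ^d. -/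
noncomputable def pev {d : ℕ} (p : MvPolynomial (Fin d) ℝ)
    (y : EuclideanSpace ℝ (Fin d)) : ℝ :=
  MvPolynomial.eval (fun i => y i) p

/-- Squared homogeneous Sobolev seminorm of order m over U. -/
noncomputable def sobSemiSq (d m : ℕ) (U : Set (EuclideanSpace ℝ (Fin d)))
    (f : EuclideanSpace ℝ (Fin d) → ℝ) : ℝ :=
  ∫ x in U, ‖iteratedFDeriv ℝ m f x‖ ^ 2

open MeasureTheory Set in
theorem zl_intOn {d : ℕ} {F : Type} [NormedAddCommGroup F] {u : EuclideanSpace ℝ (Fin d) → F}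
    (hu : Continuous u) (x : EuclideanSpace ℝ (Fin d)) (ρ : ℝ) :
    IntegrableOn u (Metric.ball x ρ) :=
  (hu.continuousOn.integrableOn_compact (isCompact_closedBall x ρ)).mono_set
    Metric.ball_subset_closedBall

open MeasureTheory Set in
/-- Cauchy–Schwarz against the constant function. -/
theorem zl_cs {α : Type} [MeasurableSpace α] (μ : Measure α) [IsFiniteMeasure μ] {u : α → ℝ}
    (h1 : Integrable u μ) (h2 : Integrable (fun a => u a ^ 2) μ) :
    (∫ a, u a ∂μ) ^ 2 ≤ μ.real univ * ∫ a, u a ^ 2 ∂μ := by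
  set V := μ.real univ with hV
  set I := ∫ a, u a ∂μ with hI
  have hV0 : 0 ≤ V := measureReal_nonneg
  rcases hV0.eq_or_lt with h0 | h0
  · have : μ = 0 := by
      have : μ univ = 0 := by
        rw [hV, measureReal_def, eq_comm, ENNReal.toReal_eq_zero_iff] at h0
        exact h0.resolve_right (measure_ne_top _ _)
      simpa using this
    simp [hI, this]
  · have hn : 0 ≤ ∫ a, (V * u a - I) ^ 2 ∂μ := integral_nonneg fun a => sq_nonneg _
    have he : ∫ a, (V * u a - I) ^ 2 ∂μ
        = V ^ 2 * (∫ a, u a ^ 2 ∂μ) - 2 * V * I * I + V * I ^ 2 := by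
      have : (fun a => (V * u a - I) ^ 2)
          = fun a => (V ^ 2 * u a ^ 2 - 2 * V * I * u a) + I ^ 2 := by
        ext a; ring
      rw [this, integral_add, integral_sub, integral_const_mul, integral_const_mul, integral_const,
        smul_eq_mul]
      · exact h2.const_mul _
      · exact h1.const_mul _
      · exact (h2.const_mul _).sub (h1.const_mul _)
      · exact integrable_const _
    rw [he] at hn
    have : 0 ≤ V * (V * (∫ a, u a ^ 2 ∂μ) - I ^ 2) := by nlinarith
    have := nonneg_of_mul_nonneg_right this h0
    linarith

open MeasureTheory Set in
theorem zl_translate {d : ℕ} {φ : EuclideanSpace ℝ (Fin d) → ℝ} (hφ : Continuous φ)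
    (h0 : ∀ y, 0 ≤ φ y) (x h : EuclideanSpace ℝ (Fin d)) (ρ δ : ℝ) (hh : ‖h‖ ≤ δ) :
    ∫ y in Metric.ball x ρ, φ (y + h) ≤ ∫ y in Metric.ball x (ρ + δ), φ y := by
  have hi := (zl_intOn hφ x (ρ + δ)).integrable_indicator Metric.isOpen_ball.measurableSet
  rw [← integral_indicator Metric.isOpen_ball.measurableSet,
    ← integral_indicator Metric.isOpen_ball.measurableSet,
    ← integral_add_right_eq_self ((Metric.ball x (ρ + δ)).indicator φ) h]
  apply integral_mono
  · exact (zl_intOn (by fun_prop) x ρ).integrable_indicator Metric.isOpen_ball.measurableSet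
  · exact hi.comp_add_right h
  · intro y
    by_cases hy : y ∈ Metric.ball x ρ
    · have : y + h ∈ Metric.ball x (ρ + δ) := by
        rw [Metric.mem_ball, dist_eq_norm] at hy ⊢
        calc ‖y + h - x‖ = ‖(y - x) + h‖ := by congr 1; abel
          _ ≤ ‖y - x‖ + ‖h‖ := norm_add_le _ _
          _ < _ := by linarith
      simp [indicator_of_mem hy, indicator_of_mem this]
    · simp only [indicator_of_notMem hy]
      exact indicator_nonneg (fun a _ => h0 a) _

open MeasureTheory Set in
theorem zl_dilate {d : ℕ} {φ : EuclideanSpace ℝ (Fin d) → ℝ} (hφ : Continuous φ)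
    (h0 : ∀ y, 0 ≤ φ y) (x y : EuclideanSpace ℝ (Fin d)) (R s : ℝ) (hy : y ∈ Metric.ball x R)
    (hs : 0 < s) (hs1 : s ≤ 1) :
    ∫ z in Metric.ball x R, φ (y + s • (z - y)) ≤ (s ^ d)⁻¹ * ∫ z in Metric.ball x R, φ z := by
  have hi := (zl_intOn hφ x R).integrable_indicator Metric.isOpen_ball.measurableSet
  have e : ∫ z, ((Metric.ball x R).indicator φ) (y + s • (z - y))
      = (s ^ d)⁻¹ * ∫ z in Metric.ball x R, φ z := by
    rw [← integral_indicator Metric.isOpen_ball.measurableSet]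
    rw [integral_sub_right_eq_self (fun z => ((Metric.ball x R).indicator φ) (y + s • z)) y]
    rw [Measure.integral_comp_smul volume (fun z => ((Metric.ball x R).indicator φ) (y + z)) s]
    rw [integral_add_left_eq_self ((Metric.ball x R).indicator φ) y]
    simp [abs_of_pos hs]
  rw [← e, ← integral_indicator Metric.isOpen_ball.measurableSet]
  apply integral_mono
  · exact (zl_intOn (by fun_prop) x R).integrable_indicator Metric.isOpen_ball.measurableSet
  · exact ((hi.comp_add_left y).comp_smul hs.ne').comp_sub_right y
  · intro z
    by_cases hz : z ∈ Metric.ball x R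
    · have : y + s • (z - y) ∈ Metric.ball x R :=
        (convex_ball x R).add_smul_sub_mem hy hz ⟨hs.le, hs1⟩
      simp [indicator_of_mem hz, indicator_of_mem this]
    · simp only [indicator_of_notMem hz]
      exact indicator_nonneg (fun a _ => h0 a) _

open MeasureTheory Set in
theorem zl_prodInt {d : ℕ} {u : EuclideanSpace ℝ (Fin d) × ℝ → ℝ} (hu : Continuous u)
    (x : EuclideanSpace ℝ (Fin d)) (R : ℝ) :
    Integrable u ((volume.restrict (Metric.ball x R)).prod (volume.restrict (Ioc (0:ℝ) 1))) := by
  rw [Measure.prod_restrict]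
  have : IntegrableOn u (Metric.closedBall x R ×ˢ Icc (0:ℝ) 1)
      ((volume : Measure (EuclideanSpace ℝ (Fin d))).prod (volume : Measure ℝ)) :=
    hu.continuousOn.integrableOn_compact ((isCompact_closedBall x R).prod isCompact_Icc)
  exact this.mono_set (prod_mono Metric.ball_subset_closedBall Ioc_subset_Icc_self)

open MeasureTheory Set in
theorem zl_swap {d : ℕ} {u : EuclideanSpace ℝ (Fin d) → ℝ → ℝ}
    (hu : Continuous (fun p : EuclideanSpace ℝ (Fin d) × ℝ => u p.1 p.2))
    (x : EuclideanSpace ℝ (Fin d)) (R : ℝ) :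
    IntegrableOn (fun z => ∫ s in (0:ℝ)..1, u z s) (Metric.ball x R) ∧
    IntegrableOn (fun s => ∫ z in Metric.ball x R, u z s) (Ioc (0:ℝ) 1) ∧
    ∫ z in Metric.ball x R, ∫ s in (0:ℝ)..1, u z s
      = ∫ s in (0:ℝ)..1, ∫ z in Metric.ball x R, u z s := by
  have h := zl_prodInt hu x R
  simp only [intervalIntegral.integral_of_le zero_le_one]
  exact ⟨h.integral_prod_left, h.integral_prod_right, integral_integral_swap h⟩

open MeasureTheory Set in
/-- The averaged remainder estimate. -/
theorem zl_avg (d n : ℕ) (hm : (d : ℝ) / 2 < n + 1) : ∃ K : ℝ, 0 ≤ K ∧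
    ∀ (x y : EuclideanSpace ℝ (Fin d)) (R : ℝ) (G : EuclideanSpace ℝ (Fin d) → ℝ),
      Continuous G → (∀ z, 0 ≤ G z) → y ∈ Metric.ball x R →
      ∫ z in Metric.ball x R, ∫ s in (0:ℝ)..1, s ^ n * G (y + s • (z - y))
        ≤ K * Real.sqrt (volume.real (Metric.ball x R) * ∫ z in Metric.ball x R, G z ^ 2) := by
  have hexp : -1 < (n : ℝ) - d / 2 := by linarith
  refine ⟨∫ s in (0:ℝ)..1, s ^ ((n : ℝ) - d / 2), ?_, ?_⟩
  · apply intervalIntegral.integral_nonneg zero_le_one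
    intro s hs
    exact Real.rpow_nonneg hs.1 _
  intro x y R G hG hG0 hy
  obtain ⟨-, h2, h3⟩ := zl_swap (u := fun z s => s ^ n * G (y + s • (z - y))) (by fun_prop) x R
  rw [h3, ← intervalIntegral.integral_mul_const]
  set V := volume.real (Metric.ball x R)
  set S := ∫ z in Metric.ball x R, G z ^ 2
  have hS : 0 ≤ S := integral_nonneg fun a => sq_nonneg _
  have hV : 0 ≤ V := measureReal_nonneg
  apply intervalIntegral.integral_mono_on_of_le_Ioo zero_le_one
  · rw [intervalIntegrable_iff_integrableOn_Ioc_of_le zero_le_one]; exact h2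
  · exact (intervalIntegral.intervalIntegrable_rpow' hexp).mul_const _
  intro s hs
  rw [integral_const_mul]
  have hs0 := hs.1
  have key : ∫ z in Metric.ball x R, G (y + s • (z - y)) ≤ s ^ (-((d:ℝ)/2)) * Real.sqrt (V * S) := by
    have : Fact (volume (Metric.ball x R) < ⊤) := ⟨measure_ball_lt_top⟩
    have c := zl_cs (volume.restrict (Metric.ball x R)) (u := fun z => G (y + s • (z - y)))
      (zl_intOn (by fun_prop) x R) (zl_intOn (by fun_prop) x R)
    have e := zl_dilate (φ := fun z => G z ^ 2) (by fun_prop) (fun _ => sq_nonneg _) x y R s hy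
      hs0 hs.2.le
    simp only [measureReal_restrict_apply MeasurableSet.univ, univ_inter] at c
    refine le_of_abs_le (abs_le_of_sq_le_sq ?_ (by positivity))
    rw [mul_pow, Real.sq_sqrt (by positivity), ← Real.rpow_natCast (s ^ (-((d:ℝ)/2))),
      ← Real.rpow_mul hs0.le]
    have : s ^ (-((d:ℝ)/2) * (2:ℕ)) = (s ^ d)⁻¹ := by
      rw [← Real.rpow_natCast, ← Real.rpow_neg hs0.le]; congr 1; push_cast; ring
    rw [this]
    calc _ ≤ _ := c
      _ ≤ V * ((s ^ d)⁻¹ * S) := by gcongr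
      _ = _ := by ring
  calc s ^ n * ∫ z in Metric.ball x R, G (y + s • (z - y))
      ≤ s ^ n * (s ^ (-((d:ℝ)/2)) * Real.sqrt (V * S)) := by gcongr
    _ = s ^ ((n:ℝ) - d/2) * Real.sqrt (V * S) := by
      rw [sub_eq_add_neg, Real.rpow_add hs0, Real.rpow_natCast]; ring

open MeasureTheory Set in
/-- Integrating the coefficients of a polynomial with continuous coefficients. -/
theorem zl_polyInt {d : ℕ} (P : MvPolynomial (Fin d) C(EuclideanSpace ℝ (Fin d), ℝ))
    (x : EuclideanSpace ℝ (Fin d)) (R : ℝ) :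
    ∃ Q : MvPolynomial (Fin d) ℝ, Q.totalDegree ≤ P.totalDegree ∧
      ∀ y : EuclideanSpace ℝ (Fin d), pev Q y = ∫ z in Metric.ball x R,
        P.eval₂ ((ContinuousMap.evalAlgHom ℝ ℝ z : C(EuclideanSpace ℝ (Fin d), ℝ) →ₐ[ℝ] ℝ) :
          C(EuclideanSpace ℝ (Fin d), ℝ) →+* ℝ) (fun i => y i) := by
  refine ⟨∑ β ∈ P.support, MvPolynomial.monomial β (∫ z in Metric.ball x R, P.coeff β z), ?_, ?_⟩
  · refine (MvPolynomial.totalDegree_finsetSum _ _).trans (Finset.sup_le fun β hβ => ?_)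
    exact (MvPolynomial.totalDegree_monomial_le _ _).trans (MvPolynomial.le_totalDegree hβ)
  · intro y
    simp only [MvPolynomial.eval₂_eq', pev, map_sum, MvPolynomial.eval_monomial]
    rw [integral_finsetSum]
    · refine Finset.sum_congr rfl fun β _ => ?_
      rw [integral_mul_const]
      simp [Finsupp.prod_fintype]
    · intro β _
      refine zl_intOn ?_ x R
      exact (P.coeff β).continuous.mul continuous_const

open MeasureTheory Set in
theorem zl_taylorPoly {d n : ℕ} {f : EuclideanSpace ℝ (Fin d) → ℝ} (hf : ContDiff ℝ (n + 1 : ℕ) f)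
    (x : EuclideanSpace ℝ (Fin d)) (R : ℝ) :
    ∃ Q : MvPolynomial (Fin d) ℝ, Q.totalDegree ≤ n ∧
      ∀ y : EuclideanSpace ℝ (Fin d), pev Q y = ∫ z in Metric.ball x R,
        ∑ k ∈ Finset.range (n + 1), (k.factorial : ℝ)⁻¹ •
          (iteratedFDeriv ℝ k f z (fun _ ↦ y - z)) := by
  classical
  let b := EuclideanSpace.basisFun (Fin d) ℝ
  have hc : ∀ k : ℕ, k < n + 1 → Continuous (iteratedFDeriv ℝ k f) := fun k hk =>
    hf.continuous_iteratedFDeriv (by exact_mod_cast hk.le)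
  let c : (k : ℕ) → (Fin k → Fin d) → C(EuclideanSpace ℝ (Fin d), ℝ) := fun k i =>
    if hk : k < n + 1 then
      ⟨fun z => (k.factorial : ℝ)⁻¹ • iteratedFDeriv ℝ k f z (fun j => b (i j)), by
        have := hc k hk
        fun_prop⟩
    else 0
  let co : Fin d → C(EuclideanSpace ℝ (Fin d), ℝ) := fun i => ⟨fun z => z i, by fun_prop⟩
  let P : MvPolynomial (Fin d) C(EuclideanSpace ℝ (Fin d), ℝ) :=
    ∑ k ∈ Finset.range (n + 1), ∑ i : Fin k → Fin d,
      MvPolynomial.C (c k i) * ∏ j, (MvPolynomial.X (i j) - MvPolynomial.C (co (i j)))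
  obtain ⟨Q, hQ, hQe⟩ := zl_polyInt P x R
  refine ⟨Q, hQ.trans ?_, fun y => ?_⟩
  · refine (MvPolynomial.totalDegree_finsetSum _ _).trans (Finset.sup_le fun k hk => ?_)
    refine (MvPolynomial.totalDegree_finsetSum _ _).trans (Finset.sup_le fun i _ => ?_)
    refine (MvPolynomial.totalDegree_mul _ _).trans ?_
    rw [MvPolynomial.totalDegree_C, zero_add]
    refine (MvPolynomial.totalDegree_finsetProd _ _).trans ?_
    refine (Finset.sum_le_card_nsmul _ _ 1 fun j _ => ?_).trans ?_
    · refine (MvPolynomial.totalDegree_sub _ _).trans ?_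
      simp
    · simp only [Finset.card_univ, Fintype.card_fin, smul_eq_mul, mul_one]
      have := Finset.mem_range.1 hk
      omega
  · rw [hQe]
    congr 1
    ext z
    simp only [P, MvPolynomial.eval₂_sum, MvPolynomial.eval₂_mul, MvPolynomial.eval₂_prod,
      MvPolynomial.eval₂_sub, MvPolynomial.eval₂_C, MvPolynomial.eval₂_X]
    refine Finset.sum_congr rfl fun k hk => ?_
    have hk' := Finset.mem_range.1 hk
    have hyz : y - z = ∑ i, (y i - z i) • b i := by
      conv_lhs => rw [← b.sum_repr (y - z)]
      rfl
    rw [hyz, ContinuousMultilinearMap.map_sum, Finset.smul_sum]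
    refine Finset.sum_congr rfl fun i _ => ?_
    rw [ContinuousMultilinearMap.map_smul_univ]
    simp only [c, hk', dif_pos, co, smul_eq_mul]
    change ((k.factorial : ℝ)⁻¹ • iteratedFDeriv ℝ k f z (fun j => b (i j))) *
      ∏ j, (y (i j) - z (i j)) = _
    rw [smul_eq_mul]
    ring

open MeasureTheory Set in
theorem zl_rem {d n : ℕ} {F : Type} [NormedAddCommGroup F] [NormedSpace ℝ F] [CompleteSpace F]
    {g : EuclideanSpace ℝ (Fin d) → F} (hg : ContDiff ℝ (n + 1 : ℕ) g)
    (z h : EuclideanSpace ℝ (Fin d)) :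
    ‖g (z + h) - ∑ k ∈ Finset.range (n + 1), (k.factorial : ℝ)⁻¹ •
          (iteratedFDeriv ℝ k g z (fun _ ↦ h))‖
      ≤ ‖h‖ ^ (n + 1) * ∫ t in (0:ℝ)..1, (1 - t) ^ n * ‖iteratedFDeriv ℝ (n + 1) g (z + t • h)‖ := by
  have hc : Continuous (iteratedFDeriv ℝ (n + 1) g) := hg.continuous_iteratedFDeriv le_rfl
  rw [map_add_eq_sum_add_integral_iteratedFDeriv (f := g) (x := z) (y := h) (n := n) (fun t _ => by
    exact_mod_cast hg.contDiffAt), add_sub_cancel_left, norm_smul,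
    ← intervalIntegral.integral_const_mul]
  have h1 : ‖((n.factorial : ℝ)⁻¹)‖ ≤ 1 := by
    rw [norm_inv, Real.norm_natCast]
    exact inv_le_one_of_one_le₀ (by exact_mod_cast n.factorial_pos)
  refine (mul_le_of_le_one_left (norm_nonneg _) h1).trans ?_
  refine intervalIntegral.norm_integral_le_of_norm_le zero_le_one ?_ ?_
  · refine Filter.Eventually.of_forall fun t ht => ?_
    rw [norm_smul, norm_pow, Real.norm_of_nonneg (by linarith [ht.2])]
    have := (iteratedFDeriv ℝ (n + 1) g (z + t • h)).le_opNorm (fun _ => h)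
    simp only [Finset.prod_const, Finset.card_univ, Fintype.card_fin] at this
    have h2 : 0 ≤ (1 - t) ^ n := pow_nonneg (by linarith [ht.2]) _
    calc _ ≤ (1 - t) ^ n * (‖iteratedFDeriv ℝ (n + 1) g (z + t • h)‖ * ‖h‖ ^ (n + 1)) := by gcongr
      _ = _ := by ring
  · apply Continuous.intervalIntegrable
    fun_prop

open MeasureTheory Set in
theorem zl_sup (d n : ℕ) (hm : (d : ℝ) / 2 < n + 1) (κ : ℝ) (hκ : 0 < κ) : ∃ K : ℝ, 0 ≤ K ∧
    ∀ (x : EuclideanSpace ℝ (Fin d)) (R : ℝ), 0 < R →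
      ∀ Υ : Set (EuclideanSpace ℝ (Fin d)), Υ ⊆ Metric.ball x R →
      (∀ p : MvPolynomial (Fin d) ℝ, p.totalDegree ≤ n → ∀ B : ℝ, 0 ≤ B →
        (∀ υ ∈ Υ, |pev p υ| ≤ B) →
        ∀ y ∈ Metric.ball x R, |pev p y| ≤ κ * B) →
      ∀ f : EuclideanSpace ℝ (Fin d) → ℝ, ContDiff ℝ (n + 1 : ℕ) f →
        (∀ υ ∈ Υ, f υ = 0) → ∀ y ∈ Metric.ball x R,
        f y ^ 2 * volume.real (Metric.ball x R)
          ≤ K * R ^ (2 * (n + 1)) * sobSemiSq d (n + 1) (Metric.ball x R) f := by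
  obtain ⟨K, hK, hav⟩ := zl_avg d n hm
  refine ⟨(1 + κ) ^ 2 * 2 ^ (2 * (n + 1)) * K ^ 2, by positivity, ?_⟩
  intro x R hR Υ hΥ hnorm f hf hzero
  obtain ⟨Q, hQd, hQ⟩ := zl_taylorPoly hf x R
  have hc : ∀ k ∈ Finset.range (n + 1), Continuous (iteratedFDeriv ℝ k f) := fun k hk =>
    hf.continuous_iteratedFDeriv (by exact_mod_cast (Finset.mem_range.1 hk).le)
  have hcn : Continuous (iteratedFDeriv ℝ (n + 1) f) := hf.continuous_iteratedFDeriv le_rfl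
  have hf0 : Continuous f := hf.continuous
  unfold sobSemiSq
  set V := volume.real (Metric.ball x R) with hVdef
  set S := ∫ x in Metric.ball x R, ‖iteratedFDeriv ℝ (n + 1) f x‖ ^ 2
  have hS : 0 ≤ S := integral_nonneg fun a => sq_nonneg _
  have hV : 0 < V := by
    rw [hVdef, measureReal_def]
    exact ENNReal.toReal_pos (Metric.measure_ball_pos _ _ hR).ne' measure_ball_lt_top.ne
  set W := (2 * R) ^ (n + 1) * (K * Real.sqrt (V * S)) with hW
  have hW0 : 0 ≤ W := by positivity
  have claim : ∀ y ∈ Metric.ball x R, |V * f y - pev Q y| ≤ W := by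
    intro y hy
    have e : V * f y - pev Q y = ∫ z in Metric.ball x R, (f y -
        ∑ k ∈ Finset.range (n + 1), (k.factorial : ℝ)⁻¹ •
          (iteratedFDeriv ℝ k f z (fun _ ↦ y - z))) := by
      rw [hQ, integral_sub]
      · simp [hVdef]
      · exact zl_intOn continuous_const x R
      · refine zl_intOn (continuous_finsetSum _ fun k hk => ?_) x R
        have := hc k hk
        fun_prop
    obtain ⟨h1, -, -⟩ := zl_swap
      (u := fun z s => s ^ n * ‖iteratedFDeriv ℝ (n + 1) f (y + s • (z - y))‖) (by fun_prop) x R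
    rw [e, ← Real.norm_eq_abs]
    refine (norm_integral_le_of_norm_le (h1.const_mul ((2 * R) ^ (n + 1))) ?_).trans ?_
    · filter_upwards [ae_restrict_mem Metric.isOpen_ball.measurableSet] with z hz
      have := zl_rem hf z (y - z)
      rw [add_sub_cancel] at this
      refine this.trans ?_
      have e2 : ∫ t in (0:ℝ)..1, (1 - t) ^ n * ‖iteratedFDeriv ℝ (n + 1) f (z + t • (y - z))‖
          = ∫ s in (0:ℝ)..1, s ^ n * ‖iteratedFDeriv ℝ (n + 1) f (y + s • (z - y))‖ := by
        have := intervalIntegral.integral_comp_sub_left (a := 0) (b := 1)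
          (fun s : ℝ => s ^ n * ‖iteratedFDeriv ℝ (n + 1) f (y + s • (z - y))‖) 1
        simp only [sub_self, sub_zero] at this
        rw [← this]
        congr 1
        ext t
        have e3 : z + t • (y - z) = y + (1 - t) • (z - y) := by module
        rw [e3]
      rw [e2]
      apply mul_le_mul_of_nonneg_right
      · apply pow_le_pow_left₀ (norm_nonneg _)
        rw [← dist_eq_norm]
        have := dist_triangle_right y z x
        rw [Metric.mem_ball] at hy hz
        linarith
      · apply intervalIntegral.integral_nonneg zero_le_one
        intro s hs
        have := hs.1
        positivity
    · rw [integral_const_mul]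
      exact mul_le_mul_of_nonneg_left
        (hav x y R (fun z => ‖iteratedFDeriv ℝ (n + 1) f z‖) (by fun_prop)
          (fun _ => norm_nonneg _) hy) (by positivity)
  intro y hy
  have hq := hnorm Q hQd W hW0 (fun υ hυ => by
    have := claim υ (hΥ hυ)
    rwa [hzero υ hυ, mul_zero, zero_sub, abs_neg] at this) y hy
  have hfin : |V * f y| ≤ (1 + κ) * W := by
    have := claim y hy
    calc |V * f y| = |(V * f y - pev Q y) + pev Q y| := by congr 1; ring
      _ ≤ _ := abs_add_le _ _
      _ ≤ _ := by linarith
  have hsq : (V * f y) ^ 2 ≤ ((1 + κ) * W) ^ 2 := sq_le_sq' (neg_le_of_abs_le hfin) (le_of_abs_le hfin)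
  have : V * (f y ^ 2 * V) ≤ V * ((1 + κ) ^ 2 * 2 ^ (2 * (n + 1)) * K ^ 2 * R ^ (2 * (n + 1)) * S) := by
    calc V * (f y ^ 2 * V) = (V * f y) ^ 2 := by ring
      _ ≤ _ := hsq
      _ = (1 + κ) ^ 2 * ((2 * R) ^ (n + 1)) ^ 2 * K ^ 2 * Real.sqrt (V * S) ^ 2 := by rw [hW]; ring
      _ = _ := by rw [Real.sq_sqrt (by positivity), ← pow_mul, mul_pow]; ring
  exact le_of_mul_le_mul_left this hV

theorem zl_vand (n : ℕ) (hn : 1 ≤ n) : ∃ c : Fin (n + 1) → ℝ, ∀ k < n + 1,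
    ∑ j, c j * ((j : ℝ) / (n + 1)) ^ k = if k = 1 then 1 else 0 := by
  let M := Matrix.vandermonde (fun j : Fin (n + 1) => (j : ℝ) / (n + 1))
  have hM : IsUnit M.det := by
    rw [isUnit_iff_ne_zero, Matrix.det_vandermonde_ne_zero_iff]
    intro i j hij
    have h : (n : ℝ) + 1 ≠ 0 := by positivity
    simp only [div_left_inj' h] at hij
    exact Fin.ext (by exact_mod_cast hij)
  let e : Fin (n + 1) → ℝ := fun k => if (k : ℕ) = 1 then 1 else 0
  refine ⟨Matrix.vecMul e M⁻¹, fun k hk => ?_⟩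
  have h : Matrix.vecMul (Matrix.vecMul e M⁻¹) M = e := by
    rw [Matrix.vecMul_vecMul, Matrix.nonsing_inv_mul _ hM, Matrix.vecMul_one]
  have := congrFun h ⟨k, hk⟩
  simpa [Matrix.vecMul, dotProduct, M, Matrix.vandermonde_apply, e] using this

open MeasureTheory Set in
theorem zl_step1 (d n : ℕ) (hn : 1 ≤ n) : ∃ C : ℝ, 0 ≤ C ∧
    ∀ (F : Type) [NormedAddCommGroup F] [NormedSpace ℝ F] [CompleteSpace F]
    (g : EuclideanSpace ℝ (Fin d) → F), ContDiff ℝ (n + 1 : ℕ) g →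
    ∀ (x h : EuclideanSpace ℝ (Fin d)) (ρ δ : ℝ), 0 < δ → ‖h‖ ≤ δ →
    ∫ y in Metric.ball x ρ, ‖fderiv ℝ g y h‖ ^ 2 ≤
      C * ((∫ y in Metric.ball x (ρ + δ), ‖g y‖ ^ 2) + δ ^ (2 * (n + 1)) *
        ∫ y in Metric.ball x (ρ + δ), ‖iteratedFDeriv ℝ (n + 1) g y‖ ^ 2) := by
  obtain ⟨c, hc⟩ := zl_vand n hn
  refine ⟨(∑ j, c j ^ 2) * (2 * (n + 1)), by positivity, ?_⟩
  intro F _ _ _ g hg x h ρ δ hδ hh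
  have hg0 : Continuous g := hg.continuous
  have hgn : Continuous (iteratedFDeriv ℝ (n + 1) g) := hg.continuous_iteratedFDeriv le_rfl
  have hg1 : Continuous (fderiv ℝ g) := hg.continuous_fderiv (by simp)
  let t : Fin (n + 1) → ℝ := fun j => (j : ℝ) / (n + 1)
  have ht0 : ∀ j, 0 ≤ t j := fun j => by positivity
  have ht1 : ∀ j, t j ≤ 1 := fun j => by
    have : (j : ℝ) ≤ n + 1 := by exact_mod_cast j.2.le
    exact div_le_one_of_le₀ this (by positivity)
  have hth : ∀ j, ‖t j • h‖ ≤ δ := fun j => by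
    rw [norm_smul, Real.norm_of_nonneg (ht0 j)]
    exact (mul_le_of_le_one_left (norm_nonneg _) (ht1 j)).trans hh
  let T : EuclideanSpace ℝ (Fin d) → EuclideanSpace ℝ (Fin d) → F := fun y v =>
    ∑ k ∈ Finset.range (n + 1), (k.factorial : ℝ)⁻¹ • (iteratedFDeriv ℝ k g y (fun _ ↦ v))
  let J : EuclideanSpace ℝ (Fin d) → Fin (n + 1) → ℝ := fun y j =>
    ∫ s in (0:ℝ)..1, ‖iteratedFDeriv ℝ (n + 1) g (y + s • (t j • h))‖ ^ 2
  have hT : ∀ y, fderiv ℝ g y h = ∑ j, c j • T y (t j • h) := by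
    intro y
    have : ∀ j, c j • T y (t j • h) = ∑ k ∈ Finset.range (n + 1),
        (c j * t j ^ k) • ((k.factorial : ℝ)⁻¹ • iteratedFDeriv ℝ k g y (fun _ ↦ h)) := by
      intro j
      simp only [T, Finset.smul_sum]
      refine Finset.sum_congr rfl fun k _ => ?_
      have := (iteratedFDeriv ℝ k g y).map_smul_univ (fun _ => t j) (fun _ => h)
      simp only [Finset.prod_const, Finset.card_univ, Fintype.card_fin] at this
      rw [this]
      simp only [smul_smul]
      congr 1
      ring
    simp only [this]
    rw [Finset.sum_comm]
    simp only [← Finset.sum_smul]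
    rw [Finset.sum_congr rfl (fun k hk => by rw [hc k (Finset.mem_range.1 hk)])]
    rw [Finset.sum_eq_single 1]
    · simp
    · intro k _ hk; simp [hk]
    · intro h1; simp at h1; omega
  have hR : ∀ y j, ‖T y (t j • h)‖ ^ 2 ≤ 2 * (‖g (y + t j • h)‖ ^ 2 + δ ^ (2 * (n + 1)) * J y j) := by
    intro y j
    have h1 := zl_rem hg y (t j • h)
    have hI : ∫ s in (0:ℝ)..1, (1 - s) ^ n * ‖iteratedFDeriv ℝ (n + 1) g (y + s • (t j • h))‖ ≤
        ∫ s in (0:ℝ)..1, ‖iteratedFDeriv ℝ (n + 1) g (y + s • (t j • h))‖ := by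
      apply intervalIntegral.integral_mono_on zero_le_one
      · apply Continuous.intervalIntegrable; fun_prop
      · apply Continuous.intervalIntegrable; fun_prop
      · intro s hs
        exact mul_le_of_le_one_left (norm_nonneg _)
          (pow_le_one₀ (by linarith [hs.2]) (by linarith [hs.1]))
    have hJ : (∫ s in (0:ℝ)..1, ‖iteratedFDeriv ℝ (n + 1) g (y + s • (t j • h))‖) ^ 2 ≤ J y j := by
      simp only [J, intervalIntegral.integral_of_le zero_le_one]
      have := zl_cs (volume.restrict (Ioc (0:ℝ) 1))
        (u := fun s => ‖iteratedFDeriv ℝ (n + 1) g (y + s • (t j • h))‖)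
        (Continuous.integrableOn_Ioc (by fun_prop)) (Continuous.integrableOn_Ioc (by fun_prop))
      simpa using this
    set I := ∫ s in (0:ℝ)..1, ‖iteratedFDeriv ℝ (n + 1) g (y + s • (t j • h))‖
    have hI0 : 0 ≤ I := intervalIntegral.integral_nonneg zero_le_one fun s _ => norm_nonneg _
    have h2 : ‖g (y + t j • h) - T y (t j • h)‖ ≤ δ ^ (n + 1) * I := by
      refine h1.trans ?_
      calc _ ≤ ‖t j • h‖ ^ (n + 1) * I := by gcongr
        _ ≤ _ := by gcongr; exact hth j
    have h3 : ‖T y (t j • h)‖ ≤ ‖g (y + t j • h)‖ + δ ^ (n + 1) * I := by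
      have := norm_sub_norm_le (T y (t j • h)) (g (y + t j • h))
      rw [norm_sub_rev] at this
      linarith
    calc ‖T y (t j • h)‖ ^ 2 ≤ (‖g (y + t j • h)‖ + δ ^ (n + 1) * I) ^ 2 := by gcongr
      _ ≤ 2 * (‖g (y + t j • h)‖ ^ 2 + (δ ^ (n + 1) * I) ^ 2) := add_sq_le
      _ = 2 * (‖g (y + t j • h)‖ ^ 2 + δ ^ (2 * (n + 1)) * I ^ 2) := by ring
      _ ≤ _ := by gcongr
  have hpt : ∀ y, ‖fderiv ℝ g y h‖ ^ 2 ≤ (∑ j, c j ^ 2) *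
      ∑ j, 2 * (‖g (y + t j • h)‖ ^ 2 + δ ^ (2 * (n + 1)) * J y j) := by
    intro y
    calc ‖fderiv ℝ g y h‖ ^ 2 ≤ (∑ j, |c j| * ‖T y (t j • h)‖) ^ 2 := by
          gcongr
          rw [hT y]
          refine (norm_sum_le _ _).trans (Finset.sum_le_sum fun j _ => ?_)
          rw [norm_smul, Real.norm_eq_abs]
      _ ≤ (∑ j, |c j| ^ 2) * ∑ j, ‖T y (t j • h)‖ ^ 2 := Finset.sum_mul_sq_le_sq_mul_sq _ _ _
      _ ≤ _ := by
          simp only [sq_abs]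
          gcongr with j
          exact hR y j
  have hsw := fun j => zl_swap
      (u := fun y s => ‖iteratedFDeriv ℝ (n + 1) g (y + s • (t j • h))‖ ^ 2) (by fun_prop) x ρ
  have hint1 : ∀ j, IntegrableOn (fun y => ‖g (y + t j • h)‖ ^ 2) (Metric.ball x ρ) :=
    fun j => zl_intOn (by fun_prop) x ρ
  have hint2 : ∀ j, IntegrableOn (fun y => J y j) (Metric.ball x ρ) := fun j => (hsw j).1
  have hint : ∀ j, IntegrableOn (fun y => 2 * (‖g (y + t j • h)‖ ^ 2 + δ ^ (2 * (n + 1)) * J y j))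
      (Metric.ball x ρ) := fun j => ((hint1 j).add ((hint2 j).const_mul _)).const_mul _
  set A := ∫ y in Metric.ball x (ρ + δ), ‖g y‖ ^ 2
  set S := ∫ y in Metric.ball x (ρ + δ), ‖iteratedFDeriv ℝ (n + 1) g y‖ ^ 2
  calc ∫ y in Metric.ball x ρ, ‖fderiv ℝ g y h‖ ^ 2
      ≤ ∫ y in Metric.ball x ρ, (∑ j, c j ^ 2) *
          ∑ j, 2 * (‖g (y + t j • h)‖ ^ 2 + δ ^ (2 * (n + 1)) * J y j) := by
        apply integral_mono
        · exact zl_intOn (by fun_prop) x ρ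
        · exact (integrable_finsetSum _ fun j _ => hint j).const_mul _
        · exact hpt
    _ = (∑ j, c j ^ 2) * ∑ j, 2 * ((∫ y in Metric.ball x ρ, ‖g (y + t j • h)‖ ^ 2) +
          δ ^ (2 * (n + 1)) * ∫ y in Metric.ball x ρ, J y j) := by
        rw [integral_const_mul, integral_finsetSum _ fun j _ => hint j]
        congr 1
        refine Finset.sum_congr rfl fun j _ => ?_
        rw [integral_const_mul, integral_add (hint1 j) ((hint2 j).const_mul _), integral_const_mul]
    _ ≤ (∑ j, c j ^ 2) * ∑ j : Fin (n + 1), 2 * (A + δ ^ (2 * (n + 1)) * S) := by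
        gcongr with j
        · exact zl_translate (φ := fun y => ‖g y‖ ^ 2) (by fun_prop) (fun _ => sq_nonneg _) x
            (t j • h) ρ δ (hth j)
        · rw [(hsw j).2.2]
          have : S = ∫ s in (0:ℝ)..1, S := by simp
          rw [this]
          apply intervalIntegral.integral_mono_on zero_le_one
          · rw [intervalIntegrable_iff_integrableOn_Ioc_of_le zero_le_one]; exact (hsw j).2.1
          · exact intervalIntegrable_const
          · intro s hs
            refine zl_translate (φ := fun y => ‖iteratedFDeriv ℝ (n + 1) g y‖ ^ 2) (by fun_prop)
              (fun _ => sq_nonneg _) x (s • (t j • h)) ρ δ ?_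
            rw [norm_smul, Real.norm_of_nonneg hs.1]
            exact (mul_le_of_le_one_left (norm_nonneg _) hs.2).trans (hth j)
    _ = _ := by
        simp only [Finset.sum_const, Finset.card_univ, Fintype.card_fin, nsmul_eq_mul]
        push_cast
        ring

open MeasureTheory Set in
theorem zl_step2 (d n : ℕ) (hn : 1 ≤ n) : ∃ C : ℝ, 0 ≤ C ∧
    ∀ (F : Type) [NormedAddCommGroup F] [NormedSpace ℝ F] [CompleteSpace F]
    (g : EuclideanSpace ℝ (Fin d) → F), ContDiff ℝ (n + 1 : ℕ) g →
    ∀ (x : EuclideanSpace ℝ (Fin d)) (ρ δ : ℝ), 0 < δ →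
    δ ^ 2 * ∫ y in Metric.ball x ρ, ‖fderiv ℝ g y‖ ^ 2 ≤
      C * ((∫ y in Metric.ball x (ρ + δ), ‖g y‖ ^ 2) + δ ^ (2 * (n + 1)) *
        ∫ y in Metric.ball x (ρ + δ), ‖iteratedFDeriv ℝ (n + 1) g y‖ ^ 2) := by
  obtain ⟨C, hC, h1⟩ := zl_step1 d n hn
  refine ⟨d * (d * C), by positivity, ?_⟩
  intro F _ _ _ g hg x ρ δ hδ
  have hg1 : Continuous (fderiv ℝ g) := hg.continuous_fderiv (by simp)
  let b := EuclideanSpace.basisFun (Fin d) ℝ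
  have hb : ∀ i, ‖δ • b i‖ ≤ δ := fun i => by
    rw [norm_smul, b.norm_eq_one, mul_one, Real.norm_of_nonneg hδ.le]
  have hpt : ∀ y, δ ^ 2 * ‖fderiv ℝ g y‖ ^ 2 ≤ d * ∑ i, ‖fderiv ℝ g y (δ • b i)‖ ^ 2 := by
    intro y
    have hle : ‖fderiv ℝ g y‖ ≤ ∑ i, ‖fderiv ℝ g y (b i)‖ := by
      refine ContinuousLinearMap.opNorm_le_bound _ (by positivity) fun v => ?_
      conv_lhs => rw [← b.sum_repr v]
      rw [map_sum, Finset.sum_mul]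
      refine (norm_sum_le _ _).trans (Finset.sum_le_sum fun i _ => ?_)
      rw [map_smul, norm_smul, mul_comm]
      gcongr
      exact PiLp.norm_apply_le v i
    have h2 : ∀ i, ‖fderiv ℝ g y (δ • b i)‖ = δ * ‖fderiv ℝ g y (b i)‖ := fun i => by
      rw [map_smul, norm_smul, Real.norm_of_nonneg hδ.le]
    calc δ ^ 2 * ‖fderiv ℝ g y‖ ^ 2 = (δ * ‖fderiv ℝ g y‖) ^ 2 := by ring
      _ ≤ (∑ i, ‖fderiv ℝ g y (δ • b i)‖) ^ 2 := by
          simp only [h2, ← Finset.mul_sum]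
          gcongr
      _ ≤ _ := by
          have := sq_sum_le_card_mul_sum_sq (s := (Finset.univ : Finset (Fin d)))
            (f := fun i => ‖fderiv ℝ g y (δ • b i)‖)
          simpa using this
  have hint : ∀ i, IntegrableOn (fun y => ‖fderiv ℝ g y (δ • b i)‖ ^ 2) (Metric.ball x ρ) :=
    fun i => zl_intOn (by fun_prop) x ρ
  rw [← integral_const_mul]
  calc _ ≤ ∫ y in Metric.ball x ρ, d * ∑ i, ‖fderiv ℝ g y (δ • b i)‖ ^ 2 := by
        apply integral_mono
        · exact zl_intOn (by fun_prop) x ρ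
        · exact (integrable_finsetSum _ fun j _ => hint j).const_mul _
        · exact hpt
    _ = d * ∑ i, ∫ y in Metric.ball x ρ, ‖fderiv ℝ g y (δ • b i)‖ ^ 2 := by
        rw [integral_const_mul, integral_finsetSum _ fun j _ => hint j]
    _ ≤ d * ∑ i : Fin d, C * ((∫ y in Metric.ball x (ρ + δ), ‖g y‖ ^ 2) + δ ^ (2 * (n + 1)) *
        ∫ y in Metric.ball x (ρ + δ), ‖iteratedFDeriv ℝ (n + 1) g y‖ ^ 2) := by
        gcongr with i
        exact h1 F g hg x (δ • b i) ρ δ hδ (hb i)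
    _ = _ := by
        simp only [Finset.sum_const, Finset.card_univ, Fintype.card_fin, nsmul_eq_mul]
        ring

open MeasureTheory Set in
theorem zl_ballMono {d : ℕ} {φ : EuclideanSpace ℝ (Fin d) → ℝ} (hφ : Continuous φ)
    (h0 : ∀ y, 0 ≤ φ y) (x : EuclideanSpace ℝ (Fin d)) {ρ ρ' : ℝ} (h : ρ ≤ ρ') :
    ∫ y in Metric.ball x ρ, φ y ≤ ∫ y in Metric.ball x ρ', φ y :=
  setIntegral_mono_set (zl_intOn hφ x ρ') (Filter.Eventually.of_forall h0)
    (Metric.ball_subset_ball h).eventuallyLE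

open MeasureTheory Set in
theorem zl_interp (d k : ℕ) : ∀ n : ℕ, k ≤ n → ∃ C : ℝ, 0 ≤ C ∧
    ∀ (F : Type) [NormedAddCommGroup F] [NormedSpace ℝ F] [CompleteSpace F]
    (g : EuclideanSpace ℝ (Fin d) → F), ContDiff ℝ (n + 1 : ℕ) g →
    ∀ (x : EuclideanSpace ℝ (Fin d)) (ρ δ : ℝ), 0 < δ →
    δ ^ (2 * k) * ∫ y in Metric.ball x ρ, ‖iteratedFDeriv ℝ k g y‖ ^ 2 ≤
      C * ((∫ y in Metric.ball x (ρ + k * δ), ‖g y‖ ^ 2) + δ ^ (2 * (n + 1)) *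
        ∫ y in Metric.ball x (ρ + k * δ), ‖iteratedFDeriv ℝ (n + 1) g y‖ ^ 2) := by
  induction k with
  | zero =>
    intro n _
    refine ⟨1, zero_le_one, ?_⟩
    intro F _ _ _ g hg x ρ δ hδ
    simp only [mul_zero, pow_zero, one_mul, norm_iteratedFDeriv_zero, Nat.cast_zero, zero_mul,
      add_zero]
    have : 0 ≤ ∫ y in Metric.ball x ρ, ‖iteratedFDeriv ℝ (n + 1) g y‖ ^ 2 :=
      integral_nonneg fun a => sq_nonneg _
    have := mul_nonneg (pow_nonneg hδ.le (2 * (n + 1))) this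
    linarith
  | succ k ih =>
    intro n hk
    obtain ⟨n, rfl⟩ : ∃ n', n = n' + 1 := ⟨n - 1, by omega⟩
    obtain ⟨C₁, hC₁, h₁⟩ := ih n (by omega)
    obtain ⟨C₂, hC₂, h₂⟩ := zl_step2 d (n + 1) (by omega)
    refine ⟨C₁ * (C₂ + 1), by positivity, ?_⟩
    intro F _ _ _ g hg x ρ δ hδ
    have hgn : Continuous (iteratedFDeriv ℝ (n + 1 + 1) g) := hg.continuous_iteratedFDeriv le_rfl
    have a1 := h₁ _ (fderiv ℝ g) (hg.fderiv_right (by norm_cast)) x ρ δ hδ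
    have a2 := h₂ F g hg x (ρ + k * δ) δ hδ
    simp only [norm_iteratedFDeriv_fderiv] at a1
    have er : ρ + ((k + 1 : ℕ) : ℝ) * δ = ρ + k * δ + δ := by push_cast; ring
    rw [er]
    have a3 := zl_ballMono (φ := fun y => ‖iteratedFDeriv ℝ (n + 1 + 1) g y‖ ^ 2) (by fun_prop)
      (fun _ => sq_nonneg _) x (show ρ + k * δ ≤ ρ + k * δ + δ by linarith)
    set A := ∫ y in Metric.ball x (ρ + k * δ + δ), ‖g y‖ ^ 2
    set S := ∫ y in Metric.ball x (ρ + k * δ + δ), ‖iteratedFDeriv ℝ (n + 1 + 1) g y‖ ^ 2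
    set S' := ∫ y in Metric.ball x (ρ + k * δ), ‖iteratedFDeriv ℝ (n + 1 + 1) g y‖ ^ 2
    set D := ∫ y in Metric.ball x (ρ + k * δ), ‖fderiv ℝ g y‖ ^ 2
    have hA : 0 ≤ A := integral_nonneg fun a => sq_nonneg _
    calc δ ^ (2 * (k + 1)) * ∫ y in Metric.ball x ρ, ‖iteratedFDeriv ℝ (k + 1) g y‖ ^ 2
        = δ ^ 2 * (δ ^ (2 * k) * ∫ y in Metric.ball x ρ, ‖iteratedFDeriv ℝ (k + 1) g y‖ ^ 2) := by
          ring
      _ ≤ δ ^ 2 * (C₁ * (D + δ ^ (2 * (n + 1)) * S')) := by gcongr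
      _ = C₁ * (δ ^ 2 * D + δ ^ (2 * (n + 1 + 1)) * S') := by ring
      _ ≤ C₁ * (C₂ * (A + δ ^ (2 * (n + 1 + 1)) * S) + (A + δ ^ (2 * (n + 1 + 1)) * S)) := by
          gcongr
          have : δ ^ (2 * (n + 1 + 1)) * S' ≤ δ ^ (2 * (n + 1 + 1)) * S := by gcongr
          linarith
      _ = _ := by ring

/-- Zeros Lemma: if Υ ⊆ B(x,3r) norms polynomials of degree ≤ m−1 with constant κ
and f vanishes on Υ, then the lower-order seminorms of f on B(x,r) (suitably scaled)
are controlled by the order-m seminorm of f on B(x,3r). -/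
theorem stmt4 (d m : ℕ) (hm : (d : ℝ) / 2 < m) (κ : ℝ) (hκ : 0 < κ) :
    ∃ C : ℝ, 0 < C ∧ ∀ (x : EuclideanSpace ℝ (Fin d)) (r : ℝ), 0 < r →
      ∀ Υ : Set (EuclideanSpace ℝ (Fin d)), Υ ⊆ Metric.ball x (3 * r) →
      (∀ p : MvPolynomial (Fin d) ℝ, p.totalDegree ≤ m - 1 → ∀ B : ℝ, 0 ≤ B →
        (∀ υ ∈ Υ, |pev p υ| ≤ B) →
        ∀ y ∈ Metric.ball x (3 * r), |pev p y| ≤ κ * B) →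
      ∀ f : EuclideanSpace ℝ (Fin d) → ℝ, ContDiff ℝ m f →
        (∀ υ ∈ Υ, f υ = 0) →
        ∑ k ∈ Finset.range (m + 1),
            r ^ (2 * ((k : ℤ) - m)) * sobSemiSq d k (Metric.ball x r) f
          ≤ C * sobSemiSq d m (Metric.ball x (3 * r)) f := by
  obtain ⟨n, rfl⟩ : ∃ n, m = n + 1 := by
    refine ⟨m - 1, ?_⟩
    have : m ≠ 0 := by
      rintro rfl
      have : (0:ℝ) ≤ (d:ℝ) / 2 := by positivity
      simp only [Nat.cast_zero] at hm
      linarith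
    omega
  obtain ⟨K, hK, hsup⟩ := zl_sup d n (by exact_mod_cast hm) κ hκ
  choose C hC hint using fun (k : Fin (n + 1)) => zl_interp d k n (Nat.lt_succ_iff.1 k.2)
  let D : ℕ → ℝ := fun k => if hk : k < n + 1 then
    ((n : ℝ) + 1) ^ (2 * k) * C ⟨k, hk⟩ * (K * 3 ^ (2 * (n + 1)) + 1) else 1
  have hD : ∀ k, 0 ≤ D k := fun k => by
    simp only [D]
    split_ifs with hk
    · have := hC ⟨k, hk⟩
      positivity
    · exact zero_le_one
  refine ⟨1 + ∑ k ∈ Finset.range (n + 1 + 1), D k,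
    add_pos_of_pos_of_nonneg one_pos (Finset.sum_nonneg fun k _ => hD k), ?_⟩
  intro x r hr Υ hΥ hnorm f hf hzero
  have hcn : Continuous (iteratedFDeriv ℝ (n + 1) f) := hf.continuous_iteratedFDeriv le_rfl
  have hf0 : Continuous f := hf.continuous
  have hsup' := hsup x (3 * r) (by positivity) Υ hΥ hnorm f hf hzero
  set S := sobSemiSq d (n + 1) (Metric.ball x (3 * r)) f with hSdef
  have hS : 0 ≤ S := MeasureTheory.integral_nonneg fun a => sq_nonneg _
  have hL2 : ∫ y in Metric.ball x (3 * r), ‖f y‖ ^ 2 ≤ K * (3 * r) ^ (2 * (n + 1)) * S := by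
    set V := MeasureTheory.volume.real (Metric.ball x (3 * r)) with hVdef
    have hV : 0 < V := by
      rw [hVdef, MeasureTheory.measureReal_def]
      exact ENNReal.toReal_pos (Metric.measure_ball_pos _ _ (by positivity)).ne'
        MeasureTheory.measure_ball_lt_top.ne
    have h1 : ∫ y in Metric.ball x (3 * r), ‖f y‖ ^ 2 ≤
        ∫ _y in Metric.ball x (3 * r), K * (3 * r) ^ (2 * (n + 1)) * S / V := by
      apply MeasureTheory.setIntegral_mono_on
      · exact zl_intOn (by fun_prop) x (3 * r)
      · exact zl_intOn continuous_const x (3 * r)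
      · exact Metric.isOpen_ball.measurableSet
      · intro y hy
        rw [le_div_iff₀ hV, Real.norm_eq_abs, sq_abs]
        exact hsup' y hy
    refine h1.trans (le_of_eq ?_)
    rw [MeasureTheory.setIntegral_const, ← hVdef, smul_eq_mul, mul_div_cancel₀ _ hV.ne']
  rw [add_mul, Finset.sum_mul]
  refine le_trans (Finset.sum_le_sum fun k hk => ?_) (le_add_of_nonneg_left (by simpa using hS))
  have hz : r ^ (2 * ((k : ℤ) - ((n + 1 : ℕ) : ℤ))) = r ^ (2 * k) / r ^ (2 * (n + 1)) := by
    rw [mul_sub, zpow_sub₀ hr.ne']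
    norm_cast
  rw [hz]
  by_cases hk' : k < n + 1
  · simp only [D, hk', dif_pos]
    have hp : (0 : ℝ) < (n : ℝ) + 1 := by positivity
    set δ := r / ((n : ℝ) + 1) with hδ
    have hδ0 : 0 < δ := by positivity
    have hrδ : r = ((n : ℝ) + 1) * δ := by rw [hδ]; field_simp
    have hkn : (k : ℝ) ≤ n + 1 := by exact_mod_cast hk'.le
    have hrad : r + k * δ ≤ 3 * r := by
      have : (k : ℝ) * δ ≤ ((n : ℝ) + 1) * δ := by gcongr
      linarith
    have hδr : δ ≤ r := by
      rw [hδ]; exact div_le_self hr.le (by linarith [Nat.cast_nonneg (α := ℝ) n])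
    have h1 := hint ⟨k, hk'⟩ ℝ f hf x r δ hδ0
    simp only at h1
    have h2 := zl_ballMono (φ := fun y => ‖f y‖ ^ 2) (by fun_prop) (fun _ => sq_nonneg _) x hrad
    have h3 := zl_ballMono (φ := fun y => ‖iteratedFDeriv ℝ (n + 1) f y‖ ^ 2) (by fun_prop)
      (fun _ => sq_nonneg _) x hrad
    change _ ≤ S at h3
    have hCk := hC ⟨k, hk'⟩
    set c := C ⟨k, hk'⟩
    change δ ^ (2 * k) * sobSemiSq d k (Metric.ball x r) f ≤ _ at h1
    set Z := sobSemiSq d k (Metric.ball x r) f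
    have hp2 : 0 < r ^ (2 * (n + 1)) := by positivity
    rw [div_mul_eq_mul_div, div_le_iff₀ hp2]
    calc r ^ (2 * k) * Z = ((n : ℝ) + 1) ^ (2 * k) * (δ ^ (2 * k) * Z) := by
          rw [hrδ, mul_pow]; ring
      _ ≤ ((n : ℝ) + 1) ^ (2 * k) * (c * (K * (3 * r) ^ (2 * (n + 1)) * S +
            r ^ (2 * (n + 1)) * S)) := by
          refine mul_le_mul_of_nonneg_left (h1.trans ?_) (by positivity)
          refine mul_le_mul_of_nonneg_left (add_le_add (h2.trans hL2) ?_) hCk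
          exact mul_le_mul (pow_le_pow_left₀ hδ0.le hδr _) h3
            (MeasureTheory.integral_nonneg fun a => sq_nonneg _) (by positivity)
      _ = _ := by rw [mul_pow]; ring
  · have hkk : k = n + 1 := by
      have := Finset.mem_range.1 hk
      omega
    simp only [D, hk', dif_neg, not_false_eq_true, one_mul]
    subst hkk
    rw [div_self (by positivity), one_mul]
    exact zl_ballMono (φ := fun y => ‖iteratedFDeriv ℝ (n + 1) f y‖ ^ 2) (by fun_prop)
      (fun _ => sq_nonneg _) x (by linarith)
end

section
/- (Bramble–Hilbert step) For m > d/2 and the ball B₃ = B(0,3) ⊂ ℝ^d, there is a constant C such that for every f ∈ W_2^m(B₃), there exists a polynomial p of degree ≤ m−1 with ‖f − p‖_{W_2^m(B₃)} ≤ C |f|_{W_2^m(B₃)}. -/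
/-- Homogeneous Sobolev seminorm of order m over U. -/
noncomputable def sobSemi (d m : ℕ) (U : Set (EuclideanSpace ℝ (Fin d)))
    (f : EuclideanSpace ℝ (Fin d) → ℝ) : ℝ :=
  Real.sqrt (sobSemiSq d m U f)


section BHaux

open MeasureTheory Set

lemma bh_scale {d : ℕ} (h : EuclideanSpace ℝ (Fin d) → ENNReal) (hh : Measurable h)
    (y : EuclideanSpace ℝ (Fin d)) (hy : y ∈ Metric.ball (0 : EuclideanSpace ℝ (Fin d)) 3)
    (t : ℝ) (h0 : 0 ≤ t) (h1 : t ≤ 1/2) :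
    ∫⁻ x in Metric.ball (0 : EuclideanSpace ℝ (Fin d)) 3, h ((1-t) • x + t • y) ≤
      2 ^ d * ∫⁻ x in Metric.ball (0 : EuclideanSpace ℝ (Fin d)) 3, h x := by
  set B := Metric.ball (0 : EuclideanSpace ℝ (Fin d)) 3 with hB
  have hBm : MeasurableSet B := Metric.isOpen_ball.measurableSet
  have hne : (1 - t) ≠ 0 := by linarith
  have hH : Measurable (B.indicator h) := hh.indicator hBm
  calc ∫⁻ x in B, h ((1-t) • x + t • y)
      ≤ ∫⁻ x, B.indicator h ((1-t) • x + t • y) := by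
        rw [← lintegral_indicator hBm]
        apply lintegral_mono
        intro x
        by_cases hx : x ∈ B
        · have : (1-t) • x + t • y ∈ B :=
            (convex_ball (0 : EuclideanSpace ℝ (Fin d)) 3) hx hy (by linarith) h0 (by ring)
          simp [hx, this]
        · simp [hx]
    _ = ∫⁻ z, B.indicator h (z + t • y) ∂(Measure.map (fun x => (1-t) • x) volume) := by
        rw [lintegral_map]
        · exact hH.comp (by fun_prop)
        · fun_prop
    _ = ENNReal.ofReal |((1-t) ^ d)⁻¹| * ∫⁻ x in B, h x := by
        rw [Measure.map_addHaar_smul _ hne, lintegral_smul_measure, lintegral_add_right_eq_self,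
          lintegral_indicator hBm]
        simp
    _ ≤ _ := by
        gcongr
        have : |((1-t) ^ d)⁻¹| ≤ 2 ^ d := by
          rw [abs_of_nonneg (by have : 0 ≤ 1 - t := by linarith
                                positivity), ← inv_pow]
          have : (1-t)⁻¹ ≤ 2 := by
            rw [inv_le_comm₀ (by linarith) (by norm_num)]; linarith
          have h3 : 0 ≤ (1-t)⁻¹ := by
            apply inv_nonneg.2; linarith
          gcongr
        calc _ ≤ ENNReal.ofReal (2^d) := ENNReal.ofReal_le_ofReal this
          _ = 2 ^ d := by rw [ENNReal.ofReal_pow (by norm_num)]; simp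

lemma bh_double {d : ℕ} (h : EuclideanSpace ℝ (Fin d) → ENNReal) (hh : Measurable h)
    (t : ℝ) (h0 : 0 ≤ t) (h1 : t ≤ 1) :
    ∫⁻ x in Metric.ball (0 : EuclideanSpace ℝ (Fin d)) 3,
      ∫⁻ y in Metric.ball (0 : EuclideanSpace ℝ (Fin d)) 3, h ((1-t) • x + t • y) ≤
      volume (Metric.ball (0 : EuclideanSpace ℝ (Fin d)) 3) *
        (2 ^ d * ∫⁻ x in Metric.ball (0 : EuclideanSpace ℝ (Fin d)) 3, h x) := by
  set B := Metric.ball (0 : EuclideanSpace ℝ (Fin d)) 3 with hB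
  have hBm : MeasurableSet B := Metric.isOpen_ball.measurableSet
  rcases le_total t (1/2) with ht | ht
  · rw [lintegral_lintegral_swap]
    · calc _ ≤ ∫⁻ y in B, (2 ^ d * ∫⁻ x in B, h x) :=
            setLIntegral_mono' hBm fun y hy => bh_scale h hh y hy t h0 ht
        _ = _ := by rw [setLIntegral_const, mul_comm]
    · apply Measurable.aemeasurable
      exact hh.comp (by fun_prop)
  · calc _ ≤ ∫⁻ y in B, (2 ^ d * ∫⁻ x in B, h x) :=
            setLIntegral_mono' hBm fun y hy => by
              have := bh_scale h hh y hy (1-t) (by linarith) (by linarith)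
              simpa [add_comm] using this
      _ = _ := by rw [setLIntegral_const, mul_comm]

lemma bh_cs {α : Type*} [MeasurableSpace α] (μ : Measure α) (a : α → ENNReal)
    (ha : AEMeasurable a μ) : (∫⁻ x, a x ∂μ) ^ 2 ≤ μ univ * ∫⁻ x, a x ^ 2 ∂μ := by
  have := ENNReal.lintegral_mul_le_Lp_mul_Lq μ Real.HolderConjugate.two_two
    (f := fun _ => 1) (g := a) (by fun_prop) ha
  simp only [Pi.mul_apply, one_mul, ENNReal.one_rpow, lintegral_const] at this
  calc _ ≤ _ := pow_le_pow_left' this 2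
    _ = _ := by
      rw [mul_pow, ← ENNReal.rpow_natCast, ← ENNReal.rpow_natCast, ← ENNReal.rpow_mul,
        ← ENNReal.rpow_mul]
      simp

lemma bh_ftc {d : ℕ} {V : Type*} [NormedAddCommGroup V] [NormedSpace ℝ V]
    (g : EuclideanSpace ℝ (Fin d) → V) (hg : ContDiff ℝ 1 g)
    {x y : EuclideanSpace ℝ (Fin d)} (hx : x ∈ Metric.ball (0 : EuclideanSpace ℝ (Fin d)) 3)
    (hy : y ∈ Metric.ball (0 : EuclideanSpace ℝ (Fin d)) 3) :
    ‖g x - g y‖ₑ ^ 2 ≤ 36 * ∫⁻ t in Icc (0:ℝ) 1, ‖fderiv ℝ g ((1-t) • x + t • y)‖ₑ ^ 2 := by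
  have hc : Continuous (fderiv ℝ g) := hg.continuous_fderiv (by norm_num)
  let γ : ℝ → EuclideanSpace ℝ (Fin d) := fun t => (1-t) • x + t • y
  have hγ : ContDiff ℝ 1 γ := by fun_prop
  have hd : ∀ t, HasDerivAt γ (y - x) t := by
    intro t
    have := (((hasDerivAt_id t).const_sub 1).smul_const x).add ((hasDerivAt_id t).smul_const y)
    have e' : (-1 : ℝ) • x + (1 : ℝ) • y = y - x := by simp [sub_eq_add_neg, add_comm]
    rw [← e']
    exact this
  have hdg : ∀ t, deriv (g ∘ γ) t = fderiv ℝ g (γ t) (y - x) := fun t =>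
    (((hg.differentiable (by norm_num)) (γ t)).hasFDerivAt.comp_hasDerivAt t (hd t)).deriv
  have key := enorm_sub_le_lintegral_deriv_of_contDiffOn_Icc (f := g ∘ γ)
    (a := 0) (b := 1) (hg.comp hγ).contDiffOn zero_le_one
  have e1 : ‖(g ∘ γ) 1 - (g ∘ γ) 0‖ₑ = ‖g x - g y‖ₑ := by
    simp [γ, enorm_sub_rev]
  rw [e1] at key
  have h6 : ‖y - x‖ₑ ≤ 6 := by
    have : ‖y - x‖ ≤ 6 := by
      have := norm_sub_le y x
      simp at hx hy
      linarith
    rw [← ofReal_norm]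
    calc _ ≤ ENNReal.ofReal 6 := ENNReal.ofReal_le_ofReal this
      _ = 6 := by simp
  have hm : Measurable fun t : ℝ => ‖fderiv ℝ g ((1-t) • x + t • y)‖ₑ := by
    apply Continuous.measurable
    exact continuous_enorm.comp (hc.comp (by fun_prop))
  have k2 : ‖g x - g y‖ₑ ≤ 6 * ∫⁻ t in Icc (0:ℝ) 1, ‖fderiv ℝ g ((1-t) • x + t • y)‖ₑ := by
    refine key.trans ?_
    rw [← lintegral_const_mul _ hm]
    apply lintegral_mono
    intro t
    simp only [hdg]
    calc _ ≤ ‖fderiv ℝ g (γ t)‖ₑ * ‖y - x‖ₑ := ContinuousLinearMap.le_opENorm _ _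
      _ ≤ ‖fderiv ℝ g (γ t)‖ₑ * 6 := by gcongr
      _ = _ := mul_comm _ _
  calc _ ≤ _ := pow_le_pow_left' k2 2
    _ = 36 * (∫⁻ t in Icc (0:ℝ) 1, ‖fderiv ℝ g ((1-t) • x + t • y)‖ₑ) ^ 2 := by
      rw [mul_pow]; norm_num
    _ ≤ _ := by
      gcongr
      refine (bh_cs _ _ hm.aemeasurable).trans ?_
      simp

lemma bh_poincare {d : ℕ} {V : Type*} [NormedAddCommGroup V] [NormedSpace ℝ V] [CompleteSpace V]
    (g : EuclideanSpace ℝ (Fin d) → V) (hg : ContDiff ℝ 1 g)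
    (h0 : ∫ x in Metric.ball (0 : EuclideanSpace ℝ (Fin d)) 3, g x = 0) :
    ∫⁻ x in Metric.ball (0 : EuclideanSpace ℝ (Fin d)) 3, ‖g x‖ₑ ^ 2 ≤
      36 * 2 ^ d * ∫⁻ x in Metric.ball (0 : EuclideanSpace ℝ (Fin d)) 3, ‖fderiv ℝ g x‖ₑ ^ 2 := by
  set B := Metric.ball (0 : EuclideanSpace ℝ (Fin d)) 3 with hB
  have hBm : MeasurableSet B := Metric.isOpen_ball.measurableSet
  have hc : Continuous (fderiv ℝ g) := hg.continuous_fderiv (by norm_num)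
  have hgc : Continuous g := hg.continuous
  set M := volume B with hM
  have hM0 : M ≠ 0 := (Metric.measure_ball_pos volume _ (by norm_num)).ne'
  have hMt : M ≠ ⊤ := measure_ball_lt_top.ne
  have : IsFiniteMeasure (volume.restrict B) := ⟨by simpa using hMt.lt_top⟩
  have hi : IntegrableOn g B :=
    (hgc.continuousOn.integrableOn_compact
      (isCompact_closedBall (0 : EuclideanSpace ℝ (Fin d)) 3)).mono_set Metric.ball_subset_closedBall
  let h : EuclideanSpace ℝ (Fin d) → ENNReal := fun z => ‖fderiv ℝ g z‖ₑ ^ 2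
  have hh : Measurable h := (continuous_enorm.comp hc).measurable.pow_const 2
  -- pointwise
  have hpt : ∀ x ∈ B, M * ‖g x‖ₑ ^ 2 ≤ ∫⁻ y in B, ‖g x - g y‖ₑ ^ 2 := by
    intro x _
    have e : ∫ y in B, (g x - g y) = (M.toReal) • g x := by
      rw [integral_sub (integrable_const _) hi, h0]
      simp [Measure.real, hM]
    have e2 := enorm_integral_le_lintegral_enorm (μ := volume.restrict B) (fun y => g x - g y)
    rw [e, enorm_smul] at e2
    have e3 : ‖M.toReal‖ₑ = M := by
      rw [← ofReal_norm, Real.norm_of_nonneg ENNReal.toReal_nonneg, ENNReal.ofReal_toReal hMt]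
    rw [e3] at e2
    have hmm : Measurable fun y => ‖g x - g y‖ₑ :=
      (continuous_enorm.comp (by fun_prop)).measurable
    have e4 := (pow_le_pow_left' e2 2).trans (bh_cs _ _ hmm.aemeasurable)
    rw [mul_pow, pow_two M, mul_assoc, Measure.restrict_apply_univ] at e4
    exact (ENNReal.mul_le_mul_iff_right hM0 hMt).1 e4
  have main : M * ∫⁻ x in B, ‖g x‖ₑ ^ 2 ≤ M * (36 * 2 ^ d * ∫⁻ x in B, h x) := by
    calc M * ∫⁻ x in B, ‖g x‖ₑ ^ 2 = ∫⁻ x in B, M * ‖g x‖ₑ ^ 2 := by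
          rw [lintegral_const_mul]
          exact (continuous_enorm.comp hgc).measurable.pow_const 2
      _ ≤ ∫⁻ x in B, ∫⁻ y in B, ‖g x - g y‖ₑ ^ 2 := setLIntegral_mono' hBm hpt
      _ ≤ ∫⁻ x in B, ∫⁻ y in B, 36 * ∫⁻ t in Icc (0:ℝ) 1, h ((1-t) • x + t • y) :=
          setLIntegral_mono' hBm fun x hx => setLIntegral_mono' hBm fun y hy => bh_ftc g hg hx hy
      _ = 36 * ∫⁻ x in B, ∫⁻ y in B, ∫⁻ t in Icc (0:ℝ) 1, h ((1-t) • x + t • y) := by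
          simp_rw [lintegral_const_mul' (36 : ENNReal) _ (by norm_num)]
      _ = 36 * ∫⁻ t in Icc (0:ℝ) 1, ∫⁻ x in B, ∫⁻ y in B, h ((1-t) • x + t • y) := by
          congr 1
          have : ∀ x, ∫⁻ y in B, ∫⁻ t in Icc (0:ℝ) 1, h ((1-t) • x + t • y) =
              ∫⁻ t in Icc (0:ℝ) 1, ∫⁻ y in B, h ((1-t) • x + t • y) := by
            intro x
            apply lintegral_lintegral_swap
            apply Measurable.aemeasurable
            exact hh.comp (by fun_prop)
          simp_rw [this]
          apply lintegral_lintegral_swap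
          apply Measurable.aemeasurable
          exact Measurable.lintegral_prod_right' (ν := volume.restrict B) (f := fun (q : (EuclideanSpace ℝ (Fin d) × ℝ) × EuclideanSpace ℝ (Fin d)) => h ((1-q.1.2) • q.1.1 + q.1.2 • q.2))
            (hh.comp (by fun_prop))
      _ ≤ 36 * ∫⁻ t in Icc (0:ℝ) 1, M * (2 ^ d * ∫⁻ x in B, h x) := by
          refine mul_le_mul' le_rfl ?_
          exact setLIntegral_mono' measurableSet_Icc fun t ht => bh_double h hh t ht.1 ht.2
      _ = M * (36 * 2 ^ d * ∫⁻ x in B, h x) := by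
          rw [setLIntegral_const]; simp; ring
  exact (ENNReal.mul_le_mul_iff_right hM0 hMt).1 main

lemma bh_aux {E G F : Type*} [NormedAddCommGroup E] [NormedSpace ℝ E]
    [NormedAddCommGroup G] [NormedSpace ℝ G]
    [NormedAddCommGroup F] [NormedSpace ℝ F] (u : E → G) (x a b : E)
    (h : DifferentiableAt ℝ (fderiv ℝ u) x) (T : G →L[ℝ] F) :
    fderiv ℝ (fun y => T (fderiv ℝ u y a)) x b = T (fderiv ℝ (fderiv ℝ u) x b a) := by
  have h1 := h.hasFDerivAt.clm_apply (hasFDerivAt_const a x)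
  have h2 := (T.hasFDerivAt.comp x h1).fderiv
  have h3 : (fun y => T (fderiv ℝ u y a)) = T ∘ fun y => fderiv ℝ u y a := rfl
  rw [h3, h2]
  simp

lemma bh_symm_swap {E F : Type*} [NormedAddCommGroup E] [NormedSpace ℝ E]
    [NormedAddCommGroup F] [NormedSpace ℝ F] (f : E → F) :
    ∀ (n : ℕ), ContDiff ℝ (n + 1 : ℕ) f → ∀ (x : E) (i : Fin n) (v : Fin (n + 1) → E),
      iteratedFDeriv ℝ (n + 1) f x (v ∘ Equiv.swap i.castSucc i.succ) =
        iteratedFDeriv ℝ (n + 1) f x v := by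
  intro n
  induction n with
  | zero => intro _ _ i; exact i.elim0
  | succ n ih =>
    intro hf x i v
    refine Fin.cases ?_ (fun j => ?_) i
    · -- swap of the first two arguments
      have hs : ContDiff ℝ 2 (iteratedFDeriv ℝ n f) :=
        hf.iteratedFDeriv_right (by norm_cast; omega)
      have h2 : IsSymmSndFDerivAt ℝ (iteratedFDeriv ℝ n f) x :=
        hs.contDiffAt.isSymmSndFDerivAt (by simp)
      have hform : ∀ w : Fin (n + 1 + 1) → E, iteratedFDeriv ℝ (n + 1 + 1) f x w =
          fderiv ℝ (fderiv ℝ (iteratedFDeriv ℝ n f)) x (w 0) (w 1) (Fin.tail (Fin.tail w)) := by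
        intro w
        have hd : DifferentiableAt ℝ (iteratedFDeriv ℝ (n + 1) f) x :=
          (hf.differentiable_iteratedFDeriv (by norm_cast; omega)) x
        rw [hd.iteratedFDeriv_succ_apply_left']
        have hd2 : DifferentiableAt ℝ (fderiv ℝ (iteratedFDeriv ℝ n f)) x :=
          (hs.fderiv_right (m := 1) (by norm_num)).differentiable (by norm_num) x
        exact bh_aux (iteratedFDeriv ℝ n f) x (w 1) (w 0) hd2
          (ContinuousMultilinearMap.apply ℝ (fun _ : Fin n => E) F (Fin.tail (Fin.tail w)))
      rw [hform, hform]
      have e0 : (v ∘ Equiv.swap (Fin.castSucc (0 : Fin (n+1))) (Fin.succ 0)) 0 = v 1 := by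
        simp
      have e1 : (v ∘ Equiv.swap (Fin.castSucc (0 : Fin (n+1))) (Fin.succ 0)) 1 = v 0 := by
        simp
      have e2 : Fin.tail (Fin.tail (v ∘ Equiv.swap (Fin.castSucc (0 : Fin (n+1))) (Fin.succ 0)))
          = Fin.tail (Fin.tail v) := by
        funext k
        simp only [Fin.tail, Function.comp]
        rw [Equiv.swap_apply_of_ne_of_ne]
        · simp [Fin.ext_iff]
        · simp [Fin.ext_iff]
      rw [e0, e1, e2, h2 (v 1) (v 0)]
    · have hd : DifferentiableAt ℝ (iteratedFDeriv ℝ (n + 1) f) x :=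
        (hf.differentiable_iteratedFDeriv (by norm_cast; omega)) x
      rw [hd.iteratedFDeriv_succ_apply_left', hd.iteratedFDeriv_succ_apply_left']
      have e0 : (v ∘ Equiv.swap (Fin.castSucc j.succ) (Fin.succ j.succ)) 0 = v 0 := by
        simp only [Function.comp]
        rw [Equiv.swap_apply_of_ne_of_ne]
        · simp [Fin.ext_iff]
        · simp [Fin.ext_iff]
      have e1 : Fin.tail (v ∘ Equiv.swap (Fin.castSucc j.succ) (Fin.succ j.succ)) =
          Fin.tail v ∘ Equiv.swap j.castSucc j.succ := by
        funext k
        simp only [Fin.tail, Function.comp]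
        congr 1
        rw [← Fin.succ_castSucc]
        exact ((Fin.succ_injective _).swap_apply _ _ _)
      rw [e0, e1]
      simp_rw [ih (hf.of_le (by norm_cast; omega))]

lemma bh_symm {E F : Type*} [NormedAddCommGroup E] [NormedSpace ℝ E]
    [NormedAddCommGroup F] [NormedSpace ℝ F] (f : E → F) (n : ℕ) (hf : ContDiff ℝ n f)
    (x : E) (σ : Equiv.Perm (Fin n)) (v : Fin n → E) :
    iteratedFDeriv ℝ n f x (v ∘ σ) = iteratedFDeriv ℝ n f x v := by
  cases n with
  | zero => congr 1; funext i; exact i.elim0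
  | succ n =>
    have hσ : σ ∈ Submonoid.closure (Set.range fun i : Fin n ↦ Equiv.swap i.castSucc i.succ) := by
      rw [Equiv.Perm.mclosure_swap_castSucc_succ]; trivial
    induction hσ using Submonoid.closure_induction generalizing v with
    | mem σ h =>
      obtain ⟨i, rfl⟩ := h
      exact bh_symm_swap f n hf x i v
    | one => rfl
    | mul σ τ _ _ h1 h2 =>
      rw [Equiv.Perm.coe_mul, ← Function.comp_assoc, h2, h1]

lemma bh_pev_contDiff {d : ℕ} (p : MvPolynomial (Fin d) ℝ) {n : WithTop ℕ∞} :
    ContDiff ℝ n (pev p) := by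
  unfold pev
  induction p using MvPolynomial.induction_on with
  | C a => simpa using contDiff_const
  | add p q hp hq => simpa using hp.add hq
  | mul_X p i hp =>
    simp only [map_mul, MvPolynomial.eval_X]
    exact hp.mul (by fun_prop)

/-- Every multilinear form on the diagonal is a polynomial. -/
lemma bh_poly {d k : ℕ} (A : EuclideanSpace ℝ (Fin d) [×k]→L[ℝ] ℝ) :
    ∃ q : MvPolynomial (Fin d) ℝ, q.totalDegree ≤ k ∧ ∀ x, pev q x = A (fun _ => x) := by
  refine ⟨∑ r : Fin k → Fin d, MvPolynomial.C (A fun i => EuclideanSpace.single (r i) 1) *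
    ∏ i, MvPolynomial.X (r i), ?_, ?_⟩
  · apply MvPolynomial.totalDegree_finsetSum_le
    intro r _
    refine (MvPolynomial.totalDegree_mul _ _).trans ?_
    rw [MvPolynomial.totalDegree_C, zero_add]
    refine (MvPolynomial.totalDegree_finsetProd _ _).trans ?_
    simp
  · intro x
    have hx : x = ∑ j : Fin d, x j • EuclideanSpace.single j (1 : ℝ) := by
      have := (EuclideanSpace.basisFun (Fin d) ℝ).sum_repr x
      simpa using this.symm
    conv_rhs => rw [hx]
    rw [A.map_sum (g := fun _ j => x j • EuclideanSpace.single j (1 : ℝ))]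
    simp only [pev, map_sum, map_mul, map_prod, MvPolynomial.eval_C, MvPolynomial.eval_X]
    refine Finset.sum_congr rfl fun r _ => ?_
    rw [A.map_smul_univ (fun i => x (r i)) (fun i => EuclideanSpace.single (r i) (1 : ℝ))]
    simp [mul_comm]

lemma bh_poly' {d k : ℕ} (A : EuclideanSpace ℝ (Fin d) [×k]→L[ℝ] ℝ)
    (hA : ∀ (σ : Equiv.Perm (Fin k)) v, A (v ∘ σ) = A v) :
    ∃ q : MvPolynomial (Fin d) ℝ, q.totalDegree ≤ k ∧
      (∀ x, iteratedFDeriv ℝ k (pev q) x = A) ∧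
      ∀ j, k < j → ∀ x, iteratedFDeriv ℝ j (pev q) x = 0 := by
  obtain ⟨q, hq, hqA⟩ := bh_poly ((k.factorial : ℝ)⁻¹ • A)
  have h1 : ∀ x, iteratedFDeriv ℝ k (pev q) x = A := by
    intro x
    have : pev q = fun x => ((k.factorial : ℝ)⁻¹ • A) (fun _ => x) := funext hqA
    rw [this]
    ext v
    rw [ContinuousMultilinearMap.iteratedFDeriv_comp_diagonal]
    have : ∀ σ : Equiv.Perm (Fin k), ((k.factorial : ℝ)⁻¹ • A) (fun i => v (σ i)) =
        (k.factorial : ℝ)⁻¹ * A v := fun σ => by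
      rw [← hA σ v]; rfl
    simp_rw [this]
    rw [Finset.sum_const, Finset.card_univ, Fintype.card_perm, Fintype.card_fin, nsmul_eq_mul,
      mul_inv_cancel_left₀ (by positivity)]
  refine ⟨q, hq, h1, ?_⟩
  intro j hj
  induction j, hj using Nat.le_induction with
  | base =>
    intro x
    ext v
    rw [iteratedFDeriv_succ_apply_left, funext h1]
    simp
  | succ j _ ih =>
    intro x
    ext v
    rw [iteratedFDeriv_succ_apply_left, funext ih]
    simp

lemma bh_int {d : ℕ} {V : Type*} [NormedAddCommGroup V] 
    (g : EuclideanSpace ℝ (Fin d) → V) (hg : Continuous g) :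
    IntegrableOn g (Metric.ball (0 : EuclideanSpace ℝ (Fin d)) 3) :=
  (hg.continuousOn.integrableOn_compact
      (isCompact_closedBall (0 : EuclideanSpace ℝ (Fin d)) 3)).mono_set Metric.ball_subset_closedBall

lemma bh_mean {d m : ℕ} (f : EuclideanSpace ℝ (Fin d) → ℝ) (hf : ContDiff ℝ m f) :
    ∀ n ≤ m, ∃ p : MvPolynomial (Fin d) ℝ, p.totalDegree ≤ m - 1 ∧
      (∀ x, iteratedFDeriv ℝ m (pev p) x = 0) ∧
      ∀ k < m, m ≤ n + k →
        ∫ x in Metric.ball (0 : EuclideanSpace ℝ (Fin d)) 3,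
          iteratedFDeriv ℝ k (fun x => f x - pev p x) x = 0 := by
  intro n
  induction n with
  | zero =>
    intro _
    refine ⟨0, by simp, ?_, fun k hk hk' => by omega⟩
    intro x
    have : pev (0 : MvPolynomial (Fin d) ℝ) = fun _ => 0 := by funext x; simp [pev]
    rw [this]
    simp
  | succ n ih =>
    intro hn
    obtain ⟨p, hp, hpm, hk⟩ := ih (by omega)
    set B := Metric.ball (0 : EuclideanSpace ℝ (Fin d)) 3 with hB
    obtain ⟨k, hkm⟩ : ∃ k, m = n + 1 + k := ⟨m - (n+1), by omega⟩
    set g : EuclideanSpace ℝ (Fin d) → ℝ := fun x => f x - pev p x with hgdef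
    have hg : ContDiff ℝ m g := hf.sub (bh_pev_contDiff p)
    set M : ℝ := volume.real B with hM
    have hM0 : M ≠ 0 :=
      (ENNReal.toReal_pos (Metric.measure_ball_pos volume _ (by norm_num)).ne'
        measure_ball_lt_top.ne).ne'
    have hgi : ∀ j ≤ m, IntegrableOn (iteratedFDeriv ℝ j g) B := fun j hj =>
      bh_int _ (hg.continuous_iteratedFDeriv (by exact_mod_cast hj))
    obtain ⟨q, hq, hqA, hq0⟩ := bh_poly' (M⁻¹ • ∫ x in B, iteratedFDeriv ℝ k g x) (by
      intro σ v
      simp only [smul_apply]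
      rw [ContinuousMultilinearMap.integral_apply (hgi k (by omega)),
        ContinuousMultilinearMap.integral_apply (hgi k (by omega))]
      simp_rw [bh_symm g k (hg.of_le (by exact_mod_cast (by omega : k ≤ m)))])
    have hpev : pev (p + q) = pev p + pev q := by funext x; simp [pev]
    refine ⟨p + q, ?_, ?_, ?_⟩
    · refine (MvPolynomial.totalDegree_add _ _).trans (max_le hp (hq.trans (by omega)))
    · intro x
      rw [hpev, iteratedFDeriv_add_apply (bh_pev_contDiff p).contDiffAt
        (bh_pev_contDiff q).contDiffAt, hpm, hq0 m (by omega), add_zero]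
    · intro j hj hj'
      have e : (fun x => f x - pev (p + q) x) = g - pev q := by
        funext x; simp [hpev, hgdef]; ring
      rw [e, iteratedFDeriv_sub (hg.of_le (by exact_mod_cast hj.le)) (bh_pev_contDiff q)]
      simp only [Pi.sub_apply]
      rcases (show k < j ∨ j = k by omega) with h | rfl
      · simp_rw [hq0 j h, sub_zero]
        exact hk j hj (by omega)
      · simp_rw [hqA]
        have : IsFiniteMeasure (volume.restrict B) :=
          ⟨by simpa using measure_ball_lt_top⟩
        rw [integral_sub (hgi j hj.le) (integrable_const _), integral_const, smul_smul]
        simp only [measureReal_restrict_apply_univ]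
        rw [← hM, mul_inv_cancel₀ hM0, one_smul, sub_self]

lemma bh_sq_eq {d k : ℕ} (g : EuclideanSpace ℝ (Fin d) → ℝ) (hg : ContDiff ℝ k g) :
    ENNReal.ofReal (sobSemiSq d k (Metric.ball 0 3) g) =
      ∫⁻ x in Metric.ball (0 : EuclideanSpace ℝ (Fin d)) 3, ‖iteratedFDeriv ℝ k g x‖ₑ ^ 2 := by
  unfold sobSemiSq
  rw [ofReal_integral_eq_lintegral_ofReal]
  · simp_rw [ENNReal.ofReal_pow (norm_nonneg _), ofReal_norm]
  · exact bh_int _ ((hg.continuous_iteratedFDeriv le_rfl).norm.pow 2)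
  · exact Filter.Eventually.of_forall fun x => by positivity

lemma bh_sq_nonneg {d k : ℕ} (g : EuclideanSpace ℝ (Fin d) → ℝ) :
    0 ≤ sobSemiSq d k (Metric.ball 0 3) g :=
  integral_nonneg fun x => by positivity

lemma bh_step {d k : ℕ} (g : EuclideanSpace ℝ (Fin d) → ℝ) (hg : ContDiff ℝ (k + 1 : ℕ) g)
    (h0 : ∫ x in Metric.ball (0 : EuclideanSpace ℝ (Fin d)) 3, iteratedFDeriv ℝ k g x = 0) :
    sobSemiSq d k (Metric.ball 0 3) g ≤ 36 * 2 ^ d * sobSemiSq d (k + 1) (Metric.ball 0 3) g := by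
  have h := bh_poincare (iteratedFDeriv ℝ k g)
    (hg.iteratedFDeriv_right (by norm_cast; omega)) h0
  have e : ∀ x, ‖fderiv ℝ (iteratedFDeriv ℝ k g) x‖ₑ = ‖iteratedFDeriv ℝ (k + 1) g x‖ₑ := by
    intro x
    rw [← ofReal_norm, norm_fderiv_iteratedFDeriv, ofReal_norm]
  simp_rw [e] at h
  rw [← bh_sq_eq g hg, ← bh_sq_eq g (hg.of_le (by norm_cast; omega))] at h
  have e2 : (36 * 2 ^ d : ENNReal) = ENNReal.ofReal (36 * 2 ^ d) := by
    rw [ENNReal.ofReal_mul (by norm_num), ENNReal.ofReal_pow (by norm_num)]; simp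
  rw [e2, ← ENNReal.ofReal_mul (by positivity)] at h
  exact (ENNReal.ofReal_le_ofReal_iff (mul_nonneg (by positivity) (bh_sq_nonneg g))).1 h

end BHaux

/-- Bramble–Hilbert step: on B₃ = B(0,3), each f ∈ W₂^m can be approximated by a
polynomial of degree ≤ m−1 with full Sobolev norm error controlled by the
order-m seminorm of f. -/
theorem stmt5 (d m : ℕ) (hm : (d : ℝ) / 2 < m) :
    ∃ C : ℝ, 0 < C ∧ ∀ f : EuclideanSpace ℝ (Fin d) → ℝ, ContDiff ℝ m f →
      ∃ p : MvPolynomial (Fin d) ℝ, p.totalDegree ≤ m - 1 ∧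
        Real.sqrt (∑ k ∈ Finset.range (m + 1),
            sobSemiSq d k (Metric.ball 0 3) (fun x => f x - pev p x))
          ≤ C * sobSemi d m (Metric.ball 0 3) f := by
  have hm1 : 1 ≤ m := by
    rcases Nat.eq_zero_or_pos m with h | h
    · subst h
      have : (0 : ℝ) ≤ d := Nat.cast_nonneg d
      norm_num at hm
      linarith
    · exact h
  set K : ℝ := 36 * 2 ^ d with hK
  have hK1 : 1 ≤ K := by
    have : (1 : ℝ) ≤ 2 ^ d := one_le_pow₀ (by norm_num)
    linarith
  refine ⟨Real.sqrt ((m + 1 : ℕ) * K ^ m), by positivity, fun f hf => ?_⟩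
  obtain ⟨p, hp, hpm, hmean⟩ := bh_mean f hf m le_rfl
  refine ⟨p, hp, ?_⟩
  set g : EuclideanSpace ℝ (Fin d) → ℝ := fun x => f x - pev p x with hgdef
  have hg : ContDiff ℝ m g := hf.sub (bh_pev_contDiff p)
  have htop : sobSemiSq d m (Metric.ball 0 3) g = sobSemiSq d m (Metric.ball 0 3) f := by
    have e : g = f - pev p := rfl
    unfold sobSemiSq
    rw [e, iteratedFDeriv_sub hf (bh_pev_contDiff p)]
    simp only [Pi.sub_apply, hpm, sub_zero]
  have hbound : ∀ j ≤ m, sobSemiSq d (m - j) (Metric.ball 0 3) g ≤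
      K ^ j * sobSemiSq d m (Metric.ball 0 3) g := by
    intro j
    induction j with
    | zero => intro _; simp
    | succ j ih =>
      intro hj
      have h1 := ih (by omega)
      obtain ⟨k, hk⟩ : ∃ k, m = k + (j + 1) := ⟨m - (j + 1), by omega⟩
      have e1 : m - (j + 1) = k := by omega
      have e2 : m - j = k + 1 := by omega
      rw [e1]
      rw [e2] at h1
      calc _ ≤ K * sobSemiSq d (k + 1) (Metric.ball 0 3) g :=
            bh_step g (hg.of_le (by exact_mod_cast (by omega : k + 1 ≤ m)))
              (hmean k (by omega) (by omega))
        _ ≤ K * (K ^ j * sobSemiSq d m (Metric.ball 0 3) g) := by gcongr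
        _ = _ := by ring
  unfold sobSemi
  rw [← Real.sqrt_mul (by positivity)]
  apply Real.sqrt_le_sqrt
  rw [← htop]
  calc _ ≤ ∑ k ∈ Finset.range (m + 1), K ^ m * sobSemiSq d m (Metric.ball 0 3) g := by
        apply Finset.sum_le_sum
        intro k hk
        have hk' : k ≤ m := by simp at hk; omega
        have := hbound (m - k) (by omega)
        rw [Nat.sub_sub_self hk'] at this
        refine this.trans ?_
        have h0 := bh_sq_nonneg (k := m) g
        gcongr
        omega
    _ = _ := by simp; ring
end
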